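/- Let d ≥ 1 be a natural number. For every n ≥ 1, every k ∈ ℕ, and all hermitian complex k×k matrices X_1, …, X_n, one has H_{2d}(X_1, …, X_n) ⪰ (1/C(2d, d)) · (X_1^{2d} + ⋯ + X_n^{2d}). -/

import Mathlib

open Matrix BigOperators ComplexOrder

/-- Product of ring elements along a word `w : Fin d → Fin n`:
`X_{w 0} * X_{w 1} * ⋯ * X_{w (d-1)}`. -/
noncomputable def wordProd {R : Type*} [Monoid R] {n d : ℕ} (X : Fin n → R)
    (w : Fin d → Fin n) : R :=
  (List.ofFn fun i => X (w i)).prod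

/-- Number of occurrences of the letter `j` in the word `w`. -/
def letterCount {n d : ℕ} (w : Fin d → Fin n) (j : Fin n) : ℕ :=
  (Finset.univ.filter fun i => w i = j).card

/-- Coefficient of the word `w` in the NCHS polynomial of degree `d`:
`(∏_j k_j(w)!) / d!`. -/
noncomputable def nchsCoeff {n : ℕ} (d : ℕ) (w : Fin d → Fin n) : ℝ :=
  ((∏ j : Fin n, (letterCount w j).factorial : ℕ) : ℝ) / (d.factorial : ℝ)

/-- The noncommutative complete homogeneous symmetric polynomial of degree `d`
evaluated at `X`. -/
noncomputable def nchs {R : Type*} [Ring R] [Module ℝ R] {n : ℕ} (d : ℕ)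
    (X : Fin n → R) : R :=
  ∑ w : Fin d → Fin n, nchsCoeff d w • wordProd X w

theorem Nat.factorial_add_eq_sum (d a b : ℕ) (hb : b ≤ d) :
    (a + b).factorial =
      ∑ i : Fin (d + 1), (a.factorial * a.choose i) * (b.factorial * b.choose i) := by
  have h1 : (a + b).choose b = ∑ i ∈ Finset.range (d + 1), a.choose i * b.choose i := by
    rw [Nat.add_choose_eq, Finset.Nat.sum_antidiagonal_eq_sum_range_succ
      (fun i j => a.choose i * b.choose j)]
    rw [← Finset.sum_subset (Finset.range_mono (Nat.succ_le_succ hb))]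
    · refine Finset.sum_congr rfl fun i hi => ?_
      rw [Nat.choose_symm (Nat.lt_succ_iff.mp (Finset.mem_range.mp hi))]
    · intro i _ hi
      rw [Nat.choose_eq_zero_of_lt (n := b) (by simpa using hi), mul_zero]
  rw [Fin.sum_univ_eq_sum_range
    (fun i => (a.factorial * a.choose i) * (b.factorial * b.choose i)),
    ← Nat.add_choose_mul_factorial_mul_factorial, h1,
    Finset.sum_mul, Finset.sum_mul]
  exact Finset.sum_congr rfl fun i _ => by ring

theorem letterCount_append {n d e : ℕ} (u : Fin d → Fin n) (v : Fin e → Fin n) (j : Fin n) :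
    letterCount (Fin.append u v) j = letterCount u j + letterCount v j := by
  simp only [letterCount, Finset.card_filter, Fin.sum_univ_add, Fin.append_left,
    Fin.append_right]

theorem letterCount_comp_rev {n d : ℕ} (u : Fin d → Fin n) (j : Fin n) :
    letterCount (u ∘ Fin.rev) j = letterCount u j := by
  simp only [letterCount, Finset.card_filter]
  exact Equiv.sum_comp Fin.revPerm fun i => if u i = j then 1 else 0

theorem letterCount_le {n d : ℕ} (u : Fin d → Fin n) (j : Fin n) : letterCount u j ≤ d := by
  simpa [letterCount] using Finset.card_filter_le Finset.univ fun i => u i = j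

theorem letterCount_const {n d : ℕ} (i j : Fin n) :
    letterCount (fun _ : Fin d => i) j = if i = j then d else 0 := by
  by_cases h : i = j <;> simp [letterCount, h]

theorem eq_const_of_le_letterCount {n d : ℕ} {u : Fin d → Fin n} {j : Fin n}
    (h : d ≤ letterCount u j) : u = fun _ => j := by
  have h' : (Finset.univ.filter fun i => u i = j) = Finset.univ :=
    Finset.eq_univ_of_card _ (le_antisymm (letterCount_le u j |>.trans_eq (by simp))
      (by simpa [letterCount] using h))
  funext i
  simpa using Finset.ext_iff.mp h' i

theorem wordProd_append {R : Type*} [Monoid R] {n d e : ℕ} (X : Fin n → R)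
    (u : Fin d → Fin n) (v : Fin e → Fin n) :
    wordProd X (Fin.append u v) = wordProd X u * wordProd X v := by
  have h : (fun i => X (Fin.append u v i)) = Fin.append (X ∘ u) (X ∘ v) := by
    funext i
    refine Fin.addCases (fun i => ?_) (fun i => ?_) i <;> simp
  rw [wordProd, h, List.ofFn_fin_append, List.prod_append]
  rfl

theorem wordProd_const {R : Type*} [Monoid R] {n d : ℕ} (X : Fin n → R) (j : Fin n) :
    wordProd X (fun _ : Fin d => j) = X j ^ d := by
  simp [wordProd]

theorem star_wordProd {R : Type*} [Monoid R] [StarMul R] {n d : ℕ} {X : Fin n → R}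
    (hX : ∀ j, star (X j) = X j) (u : Fin d → Fin n) :
    star (wordProd X u) = wordProd X (u ∘ Fin.rev) := by
  induction d with
  | zero => simp [wordProd]
  | succ d ih =>
    have h := ih (fun i => u i.succ)
    simp only [wordProd, Function.comp_apply] at h ⊢
    rw [List.ofFn_succ, List.prod_cons, star_mul, h, hX, List.ofFn_succ', List.concat_eq_append,
      List.prod_append, List.prod_singleton, Fin.rev_last]
    simp only [Fin.rev_castSucc]

/-- Coefficient, up to sign, of the product of Laguerre polynomials of degrees `m_j` in the
commutative monomial of the word `w`:
`∏_j k_j(w)! * C(k_j(w), m_j)`. -/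
def laguerreCoeff {n d : ℕ} (m : Fin n → Fin (d + 1)) (w : Fin d → Fin n) : ℕ :=
  ∏ j, (letterCount w j).factorial * (letterCount w j).choose (m j)

/-- The combination of the words of length `d` with coefficients `laguerreCoeff m`. -/
noncomputable def laguerreSum {R : Type*} [Ring R] [Module ℝ R] {n d : ℕ} (X : Fin n → R)
    (m : Fin n → Fin (d + 1)) : R :=
  ∑ w : Fin d → Fin n, (laguerreCoeff m w : ℝ) • wordProd X w

theorem laguerreCoeff_comp_rev {n d : ℕ} (m : Fin n → Fin (d + 1)) (w : Fin d → Fin n) :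
    laguerreCoeff m (w ∘ Fin.rev) = laguerreCoeff m w := by
  simp only [laguerreCoeff, letterCount_comp_rev]

theorem prod_factorial_letterCount_append {n d : ℕ} (u v : Fin d → Fin n) :
    ∏ j, (letterCount (Fin.append u v) j).factorial =
      ∑ m : Fin n → Fin (d + 1), laguerreCoeff m u * laguerreCoeff m v := by
  simp only [letterCount_append, laguerreCoeff, ← Finset.prod_mul_distrib]
  rw [← Fintype.prod_sum fun j (i : Fin (d + 1)) =>
    ((letterCount u j).factorial * (letterCount u j).choose i) *
      ((letterCount v j).factorial * (letterCount v j).choose i)]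
  exact Finset.prod_congr rfl fun j _ => Nat.factorial_add_eq_sum d _ _ (letterCount_le v j)

theorem laguerreCoeff_single {n d : ℕ} (j : Fin n) (w : Fin d → Fin n) :
    laguerreCoeff (Pi.single j (Fin.last d)) w = if w = fun _ => j then d.factorial else 0 := by
  split_ifs with h
  · subst h
    rw [laguerreCoeff, Finset.prod_eq_single j]
    · simp [letterCount_const]
    · intro i _ hi
      simp [letterCount_const, hi, hi.symm]
    · simp
  · refine Finset.prod_eq_zero (Finset.mem_univ j) ?_
    rw [Pi.single_eq_same, Nat.choose_eq_zero_of_lt, mul_zero]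
    exact not_le.mp fun h' => h (eq_const_of_le_letterCount h')

theorem laguerreSum_single {R : Type*} [Ring R] [Module ℝ R] {n d : ℕ} (X : Fin n → R)
    (j : Fin n) :
    laguerreSum X (Pi.single j (Fin.last d)) = (d.factorial : ℝ) • X j ^ d := by
  simp [laguerreSum, laguerreCoeff_single, wordProd_const]

theorem star_laguerreSum {R : Type*} [Ring R] [StarRing R] [Module ℝ R] [StarModule ℝ R]
    {n d : ℕ} {X : Fin n → R} (hX : ∀ j, star (X j) = X j) (m : Fin n → Fin (d + 1)) :
    star (laguerreSum X m) = laguerreSum X m := by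
  simp only [laguerreSum, star_sum, star_smul, star_trivial, star_wordProd hX]
  rw [← Equiv.sum_comp (Fin.revPerm.arrowCongr (Equiv.refl (Fin n)))
    fun w => (laguerreCoeff m w : ℝ) • wordProd X w]
  exact Finset.sum_congr rfl fun w _ => by
    rw [← laguerreCoeff_comp_rev]
    rfl

theorem factorial_smul_nchs {R : Type*} [Ring R] [Algebra ℝ R] {n : ℕ} (d : ℕ)
    (X : Fin n → R) :
    ((d + d).factorial : ℝ) • nchs (d + d) X =
      ∑ m : Fin n → Fin (d + 1), laguerreSum X m * laguerreSum X m := by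
  have hd : ((d + d).factorial : ℝ) ≠ 0 := by positivity
  simp only [nchs, nchsCoeff, Finset.smul_sum, smul_smul, mul_div_cancel₀ _ hd, laguerreSum,
    Finset.sum_mul_sum, smul_mul_smul_comm]
  rw [← Equiv.sum_comp (Fin.appendEquiv d d), Fintype.sum_prod_type]
  conv_rhs => rw [Finset.sum_comm]
  refine Finset.sum_congr rfl fun u _ => ?_
  conv_rhs => rw [Finset.sum_comm]
  refine Finset.sum_congr rfl fun v _ => ?_
  rw [show Fin.appendEquiv d d (u, v) = Fin.append u v from rfl,
    prod_factorial_letterCount_append, wordProd_append,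
    ← Finset.sum_smul]
  push_cast
  rfl

/-- The dimension-independent bound:
`H_{2d}(X₁,…,Xₙ) ⪰ (1/C(2d,d)) (X₁^{2d} + ⋯ + Xₙ^{2d})` for hermitian matrices. -/
theorem stmt_15 (d : ℕ) (hd : 1 ≤ d) (n : ℕ) (hn : 1 ≤ n) (k : ℕ)
    (X : Fin n → Matrix (Fin k) (Fin k) ℂ) (hX : ∀ j, (X j).IsHermitian) :
    (nchs (2 * d) X -
      (1 / ((2 * d).choose d : ℝ)) • ∑ j : Fin n, X j ^ (2 * d)).PosSemidef := by
  have hinj : Function.Injective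
      fun j : Fin n => (Pi.single j (Fin.last d) : Fin n → Fin (d + 1)) := by
    intro i j hij
    by_contra h
    have := congrFun hij i
    simp [h, Fin.ext_iff] at this
    omega
  set S := Finset.univ.map ⟨_, hinj⟩ with hS
  have hsplit : ((d + d).factorial : ℝ) • nchs (d + d) X =
      ((d.factorial : ℝ) * d.factorial) • ∑ j, X j ^ (d + d) +
        ∑ m ∈ Sᶜ, laguerreSum X m * laguerreSum X m := by
    rw [factorial_smul_nchs, ← Finset.sum_add_sum_compl S, hS, Finset.sum_map]
    simp [laguerreSum_single, smul_smul, pow_add, Finset.smul_sum]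
  have hchoose : (1 / ((d + d).choose d : ℝ)) =
      ((d + d).factorial : ℝ)⁻¹ * ((d.factorial : ℝ) * d.factorial) := by
    rw [Nat.add_choose, Nat.cast_div (Nat.factorial_mul_factorial_dvd_factorial_add d d)
      (by positivity)]
    simp [div_eq_mul_inv, mul_comm]
  have hkey : nchs (2 * d) X - (1 / ((2 * d).choose d : ℝ)) • ∑ j : Fin n, X j ^ (2 * d) =
      ((d + d).factorial : ℝ)⁻¹ • ∑ m ∈ Sᶜ, laguerreSum X m * laguerreSum X m := by
    rw [two_mul, hchoose, eq_sub_of_add_eq' hsplit.symm, smul_sub, smul_smul, smul_smul,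
      inv_mul_cancel₀ (by positivity), one_smul]
  rw [hkey]
  refine (posSemidef_sum _ fun m _ => ?_).smul (by positivity)
  nth_rw 1 [← star_laguerreSum hX m]
  exact posSemidef_conjTranspose_mul_self _
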